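/- Let n ≥ 2 and let S_0 be a sequence of n terms, each equal to 2 or 3, with finite tail length τ(S_0) = Ω(n), and suppose Ω(n) > Ω(n−1). Then S_0 is not weak. -/

import Mathlib

/-- `listPow Y k` is the sequence `Y` repeated `k` times (i.e. `Y^k`). -/
def listPow {α : Type*} (Y : List α) : ℕ → List α
  | 0 => []
  | k + 1 => Y ++ listPow Y k

/-- The curling number of a finite sequence `S`: the largest `k` such that
`S = X ++ Y^k` for some (possibly empty) `X` and nonempty `Y`. -/
noncomputable def CN {α : Type*} (S : List α) : ℕ :=
  sSup {k | ∃ X Y : List α, Y ≠ [] ∧ S = X ++ listPow Y k}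

/-- A nonempty sequence is primitive if it is not a power `T^i` with `i ≥ 2`. -/
def Primitive {α : Type*} (S : List α) : Prop :=
  S ≠ [] ∧ ∀ (T : List α) (i : ℕ), 2 ≤ i → S ≠ listPow T i

/-- `T` is a proper suffix of `S`: a suffix which is strictly shorter than `S`. -/
def ProperSuffix {α : Type*} (T S : List α) : Prop := T <:+ S ∧ T.length < S.length

/-- A sequence `S` with curling number `k` is robust if no proper suffix of
`S^(k+1)` has curling number `≥ k + 1`. -/
def Robust {α : Type*} (S : List α) : Prop :=
  ∀ T : List α, ProperSuffix T (listPow S (CN S + 1)) → CN T ≤ CN S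

/-- One step of the curling process: append the curling number of `S` to `S`. -/
noncomputable def nextSeq (S : List ℤ) : List ℤ := S ++ [(CN S : ℤ)]

theorem length_listPow {α : Type*} (Y : List α) (k : ℕ) :
    (listPow Y k).length = k * Y.length := by
  induction k with
  | zero => simp [listPow]
  | succ k ih => rw [listPow, List.length_append, ih]; ring

theorem bddAbove_curling {α : Type*} (S : List α) :
    BddAbove {k | ∃ X Y : List α, Y ≠ [] ∧ S = X ++ listPow Y k} := by
  refine ⟨S.length, ?_⟩
  rintro k ⟨X, Y, hY, rfl⟩
  have hY' := List.length_pos_iff.2 hY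
  rw [List.length_append, length_listPow]
  nlinarith

theorem le_CN {α : Type*} {S X Y : List α} {k : ℕ} (hY : Y ≠ []) (hS : S = X ++ listPow Y k) :
    k ≤ CN S :=
  le_csSup (bddAbove_curling S) ⟨X, Y, hY, hS⟩

theorem CN_le_CN_cons {α : Type*} (a : α) (S : List α) : CN S ≤ CN (a :: S) := by
  refine csSup_le_csSup (bddAbove_curling _) ⟨0, S, [a], by simp, by simp [listPow]⟩ ?_
  rintro k ⟨X, Y, hY, rfl⟩
  exact ⟨a :: X, Y, hY, rfl⟩

/-- Dropping the first term preserves the curling number, provided the latter is attained by a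
decomposition with a nonempty prefix. -/
theorem CN_cons_eq {α : Type*} {a : α} {S X Y : List α} (hX : X ≠ []) (hY : Y ≠ [])
    (h : a :: S = X ++ listPow Y (CN (a :: S))) : CN (a :: S) = CN S := by
  refine le_antisymm ?_ (CN_le_CN_cons a S)
  obtain ⟨b, X', rfl⟩ := List.exists_cons_of_ne_nil hX
  exact le_CN hY (List.cons.inj h).2

/-- Along a weak extension, the curling process commutes with dropping the first term. -/
theorem iterate_nextSeq_cons {a : ℤ} {S : List ℤ} {t : ℕ}
    (hweak : ∀ r : ℕ, r < t → ∃ X Y : List ℤ, X ≠ [] ∧ Y ≠ [] ∧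
      nextSeq^[r] (a :: S) = X ++ listPow Y (CN (nextSeq^[r] (a :: S))))
    {r : ℕ} (hr : r ≤ t) : nextSeq^[r] (a :: S) = a :: nextSeq^[r] S := by
  induction r with
  | zero => rfl
  | succ r ih =>
    obtain ⟨X, Y, hX, hY, h⟩ := hweak r hr
    have ih := ih (Nat.le_of_succ_le hr)
    rw [ih] at h
    rw [Function.iterate_succ_apply', Function.iterate_succ_apply', ih, nextSeq, nextSeq,
      CN_cons_eq hX hY h, List.cons_append]

/-- If a sequence `S₀` of `n ≥ 2` twos and threes has tail length `t = Ω(n)`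
(so every length-`n` {2,3}-sequence has tail length `≤ t`) and `Ω(n) > Ω(n-1)`
(every length-`(n-1)` {2,3}-sequence has tail length `< t`), then `S₀` is not weak:
it is not the case that every `S_r` (`r < t`) can be written as `X Y^(CN S_r)`
with `X` and `Y` nonempty. -/
theorem lemWeak (n : ℕ) (hn : 2 ≤ n) (S₀ : List ℤ)
    (hlen : S₀.length = n) (h23 : ∀ x ∈ S₀, x = 2 ∨ x = 3)
    (t : ℕ)
    (ht : CN (nextSeq^[t] S₀) = 1)
    (htmin : ∀ t' : ℕ, t' < t → CN (nextSeq^[t'] S₀) ≠ 1)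
    (hOmega : ∀ S : List ℤ, S.length = n → (∀ x ∈ S, x = 2 ∨ x = 3) →
      ∃ t' : ℕ, t' ≤ t ∧ CN (nextSeq^[t'] S) = 1)
    (hOmega' : ∀ S : List ℤ, S.length = n - 1 → (∀ x ∈ S, x = 2 ∨ x = 3) →
      ∃ t' : ℕ, t' < t ∧ CN (nextSeq^[t'] S) = 1) :
    ¬ (∀ r : ℕ, r < t → ∃ X Y : List ℤ, X ≠ [] ∧ Y ≠ [] ∧
        nextSeq^[r] S₀ = X ++ listPow Y (CN (nextSeq^[r] S₀))) := by
  intro hweak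
  obtain ⟨a, S, rfl⟩ := List.exists_cons_of_length_pos (l := S₀) (by omega)
  obtain ⟨r, hr, hCN⟩ := hOmega' S (by simp [← hlen])
    fun x hx => h23 x (List.mem_cons_of_mem a hx)
  obtain ⟨X, Y, hX, hY, h⟩ := hweak r hr
  have hcons := iterate_nextSeq_cons hweak hr.le
  rw [hcons] at h
  exact htmin r hr (by rw [hcons, CN_cons_eq hX hY h, hCN])
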